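/- arXiv:2406.02879 — 3 statements merged into one kernel-verified Lean document; each statement's English description precedes it below -/
import Mathlib

section
/- Let ξ be a random vector whose law is the standard Gaussian measure N(0, I_n) on ℝⁿ (the n-fold product of the standard real Gaussian measure of mean 0 and variance 1), let B : ℝⁿ × ℝⁿ → ℝᵏ be a bilinear map, and write B_{ij} = B(e_i, e_j) ∈ ℝᵏ for the standard basis {e_i} of ℝⁿ. Then the expectation of ‖B(ξ, ξ) − ∑_{i=1}^{n} B(e_i, e_i)‖² equals 2 ∑_{i=1}^{n} ‖B_{ii}‖² + ∑_{1 ≤ j < i ≤ n} ‖B_{ij} + B_{ji}‖², where ‖·‖ is the Euclidean norm on ℝᵏ. -/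
open MeasureTheory ProbabilityTheory

/-- The successive derivatives of `t ↦ exp (t ^ 2 / 2)` at `0` are the moments of `N(0, 1)`. -/
lemma integral_pow_gaussianReal_zero_one (n : ℕ) :
    ∫ x, x ^ n ∂gaussianReal 0 1 = iteratedDeriv n (fun t : ℝ ↦ Real.exp (t ^ 2 / 2)) 0 := by
  have h := iteratedDeriv_mgf_zero (X := id) (μ := gaussianReal 0 1)
    (by simp [integrableExpSet_id_gaussianReal]) n
  rw [mgf_id_gaussianReal] at h
  simpa using h.symm

lemma deriv_mul_exp_sq_div_two {p q : ℝ → ℝ} (hp : ∀ t, HasDerivAt p (q t) t) :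
    deriv (fun t : ℝ ↦ p t * Real.exp (t ^ 2 / 2))
      = fun t ↦ (q t + t * p t) * Real.exp (t ^ 2 / 2) := by
  funext t
  have h : HasDerivAt (fun t : ℝ ↦ t ^ 2 / 2) t t := by
    simpa using (hasDerivAt_pow 2 t).div_const 2
  refine ((hp t).fun_mul h.exp).deriv.trans ?_
  ring

lemma moments_gaussianReal_zero_one :
    ∫ x, x ^ 1 ∂gaussianReal 0 1 = 0 ∧ ∫ x, x ^ 2 ∂gaussianReal 0 1 = 1 ∧
      ∫ x, x ^ 3 ∂gaussianReal 0 1 = 0 ∧ ∫ x, x ^ 4 ∂gaussianReal 0 1 = 3 := by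
  have d1 : deriv (fun t : ℝ ↦ Real.exp (t ^ 2 / 2)) = fun t ↦ t * Real.exp (t ^ 2 / 2) := by
    simpa using deriv_mul_exp_sq_div_two (p := fun _ ↦ 1) (q := fun _ ↦ 0)
      (fun t ↦ hasDerivAt_const t 1)
  have d2 := deriv_mul_exp_sq_div_two (p := fun t ↦ t) (q := fun _ ↦ 1) (fun t ↦ hasDerivAt_id t)
  have d3 := deriv_mul_exp_sq_div_two (p := fun t ↦ 1 + t * t) (q := fun t ↦ 2 * t) fun t ↦
    (((hasDerivAt_id' t).fun_mul (hasDerivAt_id' t)).const_add 1).congr_deriv (by ring)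
  have d4 := deriv_mul_exp_sq_div_two (p := fun t ↦ 2 * t + t * (1 + t * t))
    (q := fun t ↦ 3 + 3 * t ^ 2) fun t ↦
    (((hasDerivAt_id' t).const_mul 2).fun_add ((hasDerivAt_id' t).fun_mul
      (((hasDerivAt_id' t).fun_mul (hasDerivAt_id' t)).const_add 1))).congr_deriv (by ring)
  simp only [integral_pow_gaussianReal_zero_one, iteratedDeriv_succ', iteratedDeriv_zero,
    d1, d2, d3, d4]
  norm_num

lemma integrable_pow_gaussianReal (n : ℕ) :
    Integrable (fun x : ℝ ↦ x ^ n) (gaussianReal 0 1) :=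
  integrable_pow_of_mem_interior_integrableExpSet (X := id)
    (by simp [integrableExpSet_id_gaussianReal]) n

section Wick

variable {ι : Type*} [Fintype ι] [DecidableEq ι]

/-- The exponent of the variable `m` in the monomial `xᵢ xⱼ xₖ xₗ`. -/
def quarticExponent (i j k l m : ι) : ℕ :=
  (if i = m then 1 else 0) + (if j = m then 1 else 0) + (if k = m then 1 else 0)
    + (if l = m then 1 else 0)

lemma quartic_eq_prod (x : ι → ℝ) (i j k l : ι) :
    x i * x j * x k * x l = ∏ m, x m ^ quarticExponent i j k l m := by
  simp only [quarticExponent, pow_add, Finset.prod_mul_distrib, Finset.prod_pow_boole,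
    Finset.mem_univ, if_true]

lemma integrable_quartic (i j k l : ι) :
    Integrable (fun x : ι → ℝ ↦ x i * x j * x k * x l)
      (Measure.pi fun _ : ι ↦ gaussianReal 0 1) := by
  simp only [quartic_eq_prod]
  exact Integrable.fintype_prod (f := fun m (t : ℝ) ↦ t ^ quarticExponent i j k l m)
    fun m ↦ integrable_pow_gaussianReal _

lemma memLp_two_mul (i j : ι) :
    MemLp (fun x : ι → ℝ ↦ x i * x j) 2 (Measure.pi fun _ : ι ↦ gaussianReal 0 1) := by
  rw [memLp_two_iff_integrable_sq (by fun_prop)]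
  convert integrable_quartic i j i j using 2
  ring

/-- Isserlis' theorem for four coordinates of a standard Gaussian vector. -/
lemma integral_quartic (i j k l : ι) :
    ∫ x : ι → ℝ, x i * x j * x k * x l ∂(Measure.pi fun _ : ι ↦ gaussianReal 0 1)
      = (if i = j then 1 else 0) * (if k = l then 1 else 0)
        + (if i = k then 1 else 0) * (if j = l then 1 else 0)
        + (if i = l then 1 else 0) * (if j = k then 1 else 0) := by
  obtain ⟨m1, m2, m3, m4⟩ := moments_gaussianReal_zero_one
  simp only [quartic_eq_prod]
  rw [integral_fintype_prod_eq_prod (f := fun m (t : ℝ) ↦ t ^ quarticExponent i j k l m)]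
  have hzero (m : ι) (h : quarticExponent i j k l m = 1 ∨ quarticExponent i j k l m = 3) :
      ∏ m, ∫ t, t ^ quarticExponent i j k l m ∂gaussianReal 0 1 = 0 := by
    refine Finset.prod_eq_zero (Finset.mem_univ m) ?_
    rcases h with h | h <;> rw [h] <;> assumption
  have hone (h : ∀ m, quarticExponent i j k l m = 0 ∨ quarticExponent i j k l m = 2) :
      ∏ m, ∫ t, t ^ quarticExponent i j k l m ∂gaussianReal 0 1 = 1 := by
    refine Finset.prod_eq_one fun m _ ↦ ?_
    rcases h m with h | h <;> rw [h] <;> simp [m2]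
  by_cases hall : i = j ∧ i = k ∧ i = l
  · obtain ⟨rfl, rfl, rfl⟩ := hall
    rw [Finset.prod_eq_single i (fun m _ hm ↦ by simp [quarticExponent, hm.symm]) (by simp)]
    simp [quarticExponent, m4]
    norm_num
  · by_cases hi : quarticExponent i j k l i = 1 ∨ quarticExponent i j k l i = 3
    · rw [hzero i hi]
      unfold quarticExponent at hi
      grind
    · by_cases hj : quarticExponent i j k l j = 1 ∨ quarticExponent i j k l j = 3
      · rw [hzero j hj]
        unfold quarticExponent at hi hj
        grind
      · by_cases hk : quarticExponent i j k l k = 1 ∨ quarticExponent i j k l k = 3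
        · rw [hzero k hk]
          unfold quarticExponent at hi hj hk
          grind
        · rw [hone]
          · unfold quarticExponent at hi hj hk
            grind
          · unfold quarticExponent at hi hj hk ⊢
            grind

lemma integral_mul_coord (i j : ι) :
    ∫ x : ι → ℝ, x i * x j ∂(Measure.pi fun _ : ι ↦ gaussianReal 0 1)
      = if i = j then 1 else 0 := by
  obtain ⟨m1, m2, -, -⟩ := moments_gaussianReal_zero_one
  have hprod (x : ι → ℝ) : x i * x j
      = ∏ m, x m ^ ((if i = m then 1 else 0) + (if j = m then 1 else 0)) := by
    simp only [pow_add, Finset.prod_mul_distrib, Finset.prod_pow_boole, Finset.mem_univ, if_true]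
  simp only [hprod]
  rw [integral_fintype_prod_eq_prod
    (f := fun m (t : ℝ) ↦ t ^ ((if i = m then 1 else 0) + (if j = m then 1 else 0)))]
  split_ifs with h
  · subst h
    refine Finset.prod_eq_one fun m _ ↦ ?_
    split_ifs <;> simp [m2]
  · refine Finset.prod_eq_zero (Finset.mem_univ i) ?_
    simp [Ne.symm h]

lemma memLp_two_mul_sub (i j : ι) (c : ℝ) :
    MemLp (fun x : ι → ℝ ↦ x i * x j - c) 2 (Measure.pi fun _ : ι ↦ gaussianReal 0 1) :=
  (memLp_two_mul i j).sub (memLp_const _)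

lemma integral_mul_centered (i j k l : ι) :
    ∫ x : ι → ℝ, (x i * x j - if i = j then 1 else 0) * (x k * x l - if k = l then 1 else 0)
        ∂(Measure.pi fun _ : ι ↦ gaussianReal 0 1)
      = (if i = k then 1 else 0) * (if j = l then 1 else 0)
        + (if i = l then 1 else 0) * (if j = k then 1 else 0) := by
  have h2 (i j : ι) := (memLp_two_mul i j).integrable one_le_two
  have hexp (x : ι → ℝ) :
      (x i * x j - if i = j then 1 else 0) * (x k * x l - if k = l then 1 else 0)
        = x i * x j * x k * x l - (if k = l then 1 else 0) * (x i * x j)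
          - (if i = j then 1 else 0) * (x k * x l)
          + (if i = j then 1 else 0) * (if k = l then 1 else 0) := by ring
  simp only [hexp]
  have h4 := integrable_quartic i j k l
  have hkl := (h2 i j).const_mul (if k = l then 1 else 0)
  have hij := (h2 k l).const_mul (if i = j then 1 else 0)
  rw [integral_add (by exact (h4.sub hkl).sub hij) (integrable_const _),
    integral_sub (by exact h4.sub hkl) hij, integral_sub h4 hkl,
    integral_const_mul, integral_const_mul, integral_quartic, integral_mul_coord,
    integral_mul_coord]
  simp only [integral_const, probReal_univ, one_smul]
  ring

/-- The second moment of a centered vector-valued quadratic form in a standard Gaussian vector. -/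
lemma integral_norm_sq_sum_centered {E : Type*} [NormedAddCommGroup E] [InnerProductSpace ℝ E]
    (b : ι → ι → E) :
    ∫ x : ι → ℝ, ‖∑ i, ∑ j, (x i * x j - if i = j then 1 else 0) • b i j‖ ^ 2
        ∂(Measure.pi fun _ : ι ↦ gaussianReal 0 1)
      = ∑ i, ∑ j, (inner ℝ (b i j) (b i j) + inner ℝ (b i j) (b j i)) := by
  have hexp (x : ι → ℝ) : ‖∑ i, ∑ j, (x i * x j - if i = j then 1 else 0) • b i j‖ ^ 2
      = ∑ i, ∑ j, ∑ k, ∑ l, ((x i * x j - if i = j then 1 else 0)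
          * (x k * x l - if k = l then 1 else 0)) * inner ℝ (b i j) (b k l) := by
    rw [← real_inner_self_eq_norm_sq]
    simp only [sum_inner]
    simp only [inner_sum, real_inner_smul_left, real_inner_smul_right]
    simp only [mul_assoc, mul_left_comm]
  have hint (i j k l : ι) : Integrable (fun x : ι → ℝ ↦ ((x i * x j - if i = j then 1 else 0)
      * (x k * x l - if k = l then 1 else 0)) * inner ℝ (b i j) (b k l))
      (Measure.pi fun _ : ι ↦ gaussianReal 0 1) :=
    ((memLp_two_mul_sub i j _).integrable_mul (memLp_two_mul_sub k l _)).mul_const _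
  simp only [hexp]
  rw [integral_finsetSum _ fun i _ ↦ integrable_finsetSum _ fun j _ ↦
    integrable_finsetSum _ fun k _ ↦ integrable_finsetSum _ fun l _ ↦ hint i j k l]
  refine Finset.sum_congr rfl fun i _ ↦ ?_
  rw [integral_finsetSum _ fun j _ ↦
    integrable_finsetSum _ fun k _ ↦ integrable_finsetSum _ fun l _ ↦ hint i j k l]
  refine Finset.sum_congr rfl fun j _ ↦ ?_
  rw [integral_finsetSum _ fun k _ ↦ integrable_finsetSum _ fun l _ ↦ hint i j k l]
  simp_rw [integral_finsetSum _ fun l _ ↦ hint i j _ l, integral_mul_const,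
    integral_mul_centered, add_mul, Finset.sum_add_distrib]
  simp

end Wick

lemma sum_sum_eq_diag_add_two_mul_lt {ι : Type*} [Fintype ι] [LinearOrder ι] (f : ι → ι → ℝ)
    (hf : ∀ i j, f i j = f j i) :
    ∑ i, ∑ j, f i j
      = ∑ i, f i i + 2 * ∑ i, ∑ j ∈ Finset.univ.filter (fun j ↦ j < i), f i j := by
  have hsplit (i j : ι) : f i j
      = (if i = j then f i j else 0) + (if j < i then f i j else 0)
        + (if i < j then f i j else 0) := by
    rcases lt_trichotomy i j with h | h | h
    · simp [h, h.ne, h.not_gt]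
    · simp [h]
    · simp [h, h.ne', h.not_gt]
  have hswap : ∑ i, ∑ j, (if i < j then f i j else 0) = ∑ i, ∑ j, if j < i then f i j else 0 := by
    rw [Finset.sum_comm]
    simp only [hf]
  simp only [Finset.sum_filter]
  calc ∑ i, ∑ j, f i j
      = ∑ i, ∑ j, ((if i = j then f i j else 0) + (if j < i then f i j else 0)
        + (if i < j then f i j else 0)) :=
        Finset.sum_congr rfl fun i _ ↦ Finset.sum_congr rfl fun j _ ↦ hsplit i j
    _ = _ := by
        simp only [Finset.sum_add_distrib, hswap]
        simp only [Finset.sum_ite_eq, Finset.mem_univ, if_true]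
        ring

lemma sum_inner_add_inner_swap {ι E : Type*} [Fintype ι] [LinearOrder ι] [NormedAddCommGroup E]
    [InnerProductSpace ℝ E] (b : ι → ι → E) :
    ∑ i, ∑ j, (inner ℝ (b i j) (b i j) + inner ℝ (b i j) (b j i))
      = 2 * ∑ i, ‖b i i‖ ^ 2
        + ∑ i, ∑ j ∈ Finset.univ.filter (fun j ↦ j < i), ‖b i j + b j i‖ ^ 2 := by
  have hnorm (i j : ι) : ‖b i j + b j i‖ ^ 2
      = (inner ℝ (b i j) (b i j) + inner ℝ (b i j) (b j i))
        + (inner ℝ (b j i) (b j i) + inner ℝ (b j i) (b i j)) := by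
    rw [← real_inner_self_eq_norm_sq, inner_add_left, inner_add_right, inner_add_right]
    ring
  have hdiag (i : ι) : ‖b i i + b i i‖ ^ 2 = 4 * ‖b i i‖ ^ 2 := by
    rw [← two_smul ℝ, norm_smul, mul_pow]
    norm_num
  have hsum := sum_sum_eq_diag_add_two_mul_lt (fun i j ↦ ‖b i j + b j i‖ ^ 2)
    fun i j ↦ by rw [add_comm]
  have htwo : ∑ i, ∑ j, ‖b i j + b j i‖ ^ 2
      = 2 * ∑ i, ∑ j, (inner ℝ (b i j) (b i j) + inner ℝ (b i j) (b j i)) := by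
    simp only [hnorm]
    simp_rw [Finset.sum_add_distrib (f := fun j ↦ inner ℝ (b _ j) (b _ j) + inner ℝ (b _ j) (b j _))]
    rw [Finset.sum_add_distrib, two_mul]
    congr 1
    exact Finset.sum_comm
  simp only [hdiag, ← Finset.mul_sum] at hsum
  linarith

lemma LinearMap.apply_apply_eq_sum_single {ι E : Type*} [Fintype ι] [DecidableEq ι]
    [AddCommGroup E] [Module ℝ E] (B : (ι → ℝ) →ₗ[ℝ] (ι → ℝ) →ₗ[ℝ] E) (x : ι → ℝ) :
    B x x = ∑ i, ∑ j, (x i * x j) • B (Pi.single i 1) (Pi.single j 1) := by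
  have hx (L : (ι → ℝ) →ₗ[ℝ] E) : L x = ∑ j, x j • L (Pi.single j 1) := by
    conv_lhs => rw [pi_eq_sum_univ' x]
    simp only [map_sum, map_smul]
  have hB : B x = ∑ i, x i • B (Pi.single i 1) := by
    conv_lhs => rw [pi_eq_sum_univ' x]
    simp only [map_sum, map_smul]
  rw [hB]
  simp only [LinearMap.sum_apply, LinearMap.smul_apply, hx (B (Pi.single _ 1)), Finset.smul_sum,
    smul_smul]


/-- If `ξ` has the standard Gaussian law `N(0, Iₙ)` on `ℝⁿ` and
`B : ℝⁿ × ℝⁿ → ℝᵏ` is bilinear with `Bᵢⱼ = B(eᵢ, eⱼ)`, then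
`𝔼‖B(ξ,ξ) − ∑ᵢ Bᵢᵢ‖² = 2 ∑ᵢ ‖Bᵢᵢ‖² + ∑_{j<i} ‖Bᵢⱼ + Bⱼᵢ‖²`. -/
theorem stmt_5 (n k : ℕ)
    (B : (Fin n → ℝ) →ₗ[ℝ] (Fin n → ℝ) →ₗ[ℝ] EuclideanSpace ℝ (Fin k)) :
    ∫ ξ, ‖B ξ ξ - ∑ i : Fin n, B (Pi.single i 1) (Pi.single i 1)‖ ^ 2
        ∂(Measure.pi fun _ : Fin n => gaussianReal 0 1)
      = 2 * ∑ i : Fin n, ‖B (Pi.single i 1) (Pi.single i 1)‖ ^ 2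
        + ∑ i : Fin n, ∑ j ∈ Finset.univ.filter (fun j => j < i),
            ‖B (Pi.single i 1) (Pi.single j 1)
              + B (Pi.single j 1) (Pi.single i 1)‖ ^ 2 := by
  have hB (x : Fin n → ℝ) : B x x - ∑ i : Fin n, B (Pi.single i 1) (Pi.single i 1)
      = ∑ i, ∑ j, (x i * x j - if i = j then 1 else 0) • B (Pi.single i 1) (Pi.single j 1) := by
    rw [B.apply_apply_eq_sum_single]
    simp [sub_smul, Finset.sum_sub_distrib, ite_smul]
  simp only [hB]
  rw [integral_norm_sq_sum_centered fun i j ↦ B (Pi.single i 1) (Pi.single j 1)]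
  exact sum_inner_add_inner_swap fun i j ↦ B (Pi.single i 1) (Pi.single j 1)
end

section
/- Let E be a finite-dimensional real normed vector space, let U ⊆ E be an open set, and let f : E → E be twice differentiable on U with f(f(y)) = f(y) for all y ∈ U (and f(U) ⊆ U). Let x ∈ U satisfy f(x) = x, and let v, w ∈ E satisfy D f(x) v = v and D f(x) w = w. Then D f(x) ( D²f(x)(v, w) ) = 0, where D²f(x) is the second Fréchet derivative of f at x, regarded as a symmetric bilinear map E × E → E. -/
/-- Weingarten-type identity: if `f : E → E` is twice differentiable on an open
set `U` with `f ∘ f = f` on `U`, `f(U) ⊆ U`, `x ∈ U` is a fixed point of `f`, and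
`v, w` are fixed by `D f(x)`, then `D f(x) (D²f(x)(v, w)) = 0`. -/
theorem stmt_17 {E : Type*} [NormedAddCommGroup E] [NormedSpace ℝ E]
    [FiniteDimensional ℝ E]
    (U : Set E) (hU : IsOpen U) (f : E → E)
    (hdiff : ∀ y ∈ U, DifferentiableAt ℝ f y)
    (hdiff2 : ∀ y ∈ U, DifferentiableAt ℝ (fderiv ℝ f) y)
    (hmaps : ∀ y ∈ U, f y ∈ U)
    (hidem : ∀ y ∈ U, f (f y) = f y)
    (x : E) (hx : x ∈ U) (hfx : f x = x)
    (v w : E) (hv : fderiv ℝ f x v = v) (hw : fderiv ℝ f x w = w) :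
    fderiv ℝ f x ((fderiv ℝ (fderiv ℝ f) x v) w) = 0 := by
  have h_chain : (fun y => (fderiv ℝ f (f y)).comp (fderiv ℝ f y)) =ᶠ[nhds x] fderiv ℝ f := by
    filter_upwards [hU.mem_nhds hx] with y hy
    have h_eq : (f ∘ f) =ᶠ[nhds y] f := by
      filter_upwards [hU.mem_nhds hy] with z hz using hidem z hz
    rw [← fderiv_comp y (hdiff _ (hmaps y hy)) (hdiff y hy), h_eq.fderiv_eq]
  have hf : HasFDerivAt f (fderiv ℝ f x) x := (hdiff x hx).hasFDerivAt
  have hf' : HasFDerivAt (fderiv ℝ f) (fderiv ℝ (fderiv ℝ f) x) x :=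
    (hdiff2 x hx).hasFDerivAt
  have hf'_image : HasFDerivAt (fderiv ℝ f) (fderiv ℝ (fderiv ℝ f) x) (f x) := by
    rwa [hfx]
  have h_comp := (hf'_image.comp x hf).clm_comp hf'
  have h_unique := h_comp.unique (hf'.congr_of_eventuallyEq h_chain)
  have h_apply := congrArg (fun L : E →L[ℝ] E →L[ℝ] E => L v w) h_unique
  simpa [hfx, hv, hw] using h_apply
end

section
/- Let α ≠ 0 be a real number and let c : ℝⁿ → ℝ be a differentiable function that is positively homogeneous of degree α, i.e., c(t x) = t^α c(x) for all t > 0 and x ∈ ℝⁿ. Let x ∈ ℝⁿ satisfy c(x) = 1, and define π_s(y) = c(y)^{−1/α} · y on the open set {y : c(y) > 0}. Then π_s is Fréchet differentiable at x with derivative ω ↦ ω − (Dc(x)(ω)/α) · x, where Dc(x) : ℝⁿ → ℝ is the Fréchet derivative of c at x; moreover, this linear map is idempotent. -/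
/-- Euler's identity for positively homogeneous functions. -/
theorem HasFDerivAt.apply_self_of_posHomogeneous {E : Type*} [NormedAddCommGroup E]
    [NormedSpace ℝ E] {c : E → ℝ} {c' : E →L[ℝ] ℝ} {x : E} {α : ℝ} (hc : HasFDerivAt c c' x)
    (hhomog : ∀ t : ℝ, 0 < t → c (t • x) = t ^ α * c x) : c' x = α * c x := by
  have hray : HasDerivAt (fun t : ℝ => c (t • x)) (c' x) 1 := by
    have hsmul : HasDerivAt (fun t : ℝ => t • x) x 1 := by
      simpa using (hasDerivAt_id (1 : ℝ)).smul_const x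
    exact HasFDerivAt.comp_hasDerivAt (1 : ℝ) (by simpa using hc) hsmul
  have hpow : HasDerivAt (fun t : ℝ => t ^ α * c x) (α * c x) 1 := by
    simpa using (Real.hasDerivAt_rpow_const (x := 1) (p := α) (Or.inl one_ne_zero)).mul_const (c x)
  refine hray.unique (hpow.congr_of_eventuallyEq ?_)
  filter_upwards [lt_mem_nhds (zero_lt_one' ℝ)] with t ht using hhomog t ht

/-- The derivative of a rescaling `y ↦ c y ^ p • y` at a point of the hypersurface `c = 1`. -/
theorem HasFDerivAt.rpow_const_smul_id {E : Type*} [NormedAddCommGroup E]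
    [NormedSpace ℝ E] {c : E → ℝ} {c' : E →L[ℝ] ℝ} {x : E} (hc : HasFDerivAt c c' x)
    (hx : c x = 1) (p : ℝ) :
    HasFDerivAt (fun y => c y ^ p • y)
      (ContinuousLinearMap.id ℝ E + (p • c').smulRight x) x := by
  have hpow : HasFDerivAt (fun y => c y ^ p) (p • c') x := by
    simpa [hx] using hc.rpow_const (p := p) (Or.inl (by simp [hx]))
  simpa [hx] using hpow.fun_smul (hasFDerivAt_id x)

/-- Let `c : ℝⁿ → ℝ` be differentiable and positively homogeneous of degree
`α ≠ 0`, and let `x` satisfy `c(x) = 1`. Then the rescaling retraction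
`π_s(y) = c(y)^{−1/α} • y` is Fréchet differentiable at `x` with derivative
`ω ↦ ω − (Dc(x)(ω)/α) • x`, and this derivative is idempotent. -/
theorem stmt_19 (n : ℕ) (α : ℝ) (hα : α ≠ 0)
    (c : (Fin n → ℝ) → ℝ) (hc : Differentiable ℝ c)
    (hhomog : ∀ t : ℝ, 0 < t → ∀ x : Fin n → ℝ, c (t • x) = t ^ α * c x)
    (x : Fin n → ℝ) (hx : c x = 1) :
    ∃ L : (Fin n → ℝ) →L[ℝ] (Fin n → ℝ),
      (∀ ω, L ω = ω - (fderiv ℝ c x ω / α) • x) ∧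
      HasFDerivAt (fun y : Fin n → ℝ => (c y ^ (-(1 : ℝ) / α)) • y) L x ∧
      (∀ ω, L (L ω) = L ω) := by
  have hfd := (hc x).hasFDerivAt
  have heuler : fderiv ℝ c x x = α := by
    simpa [hx] using hfd.apply_self_of_posHomogeneous fun t ht => hhomog t ht x
  have hL : ∀ ω, (ContinuousLinearMap.id ℝ (Fin n → ℝ) +
      ((-(1 : ℝ) / α) • fderiv ℝ c x).smulRight x) ω = ω - (fderiv ℝ c x ω / α) • x := by
    intro ω
    simp only [add_apply, ContinuousLinearMap.id_apply,
      ContinuousLinearMap.smulRight_apply, smul_apply, smul_eq_mul]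
    module
  refine ⟨_, hL, hfd.rpow_const_smul_id hx _, fun ω => ?_⟩
  simp only [hL, map_sub, map_smul, heuler, smul_eq_mul, div_mul_cancel₀ _ hα, sub_self,
    zero_div, zero_smul, sub_zero]
end
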